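/- (Convergence of Relative-Gradient-Descent for smooth convex objectives.) Let 𝒟 ⊆ ℝ^d be convex, closed and bounded with Euclidean diameter D, let f : 𝒟 → ℝ be convex, β-smooth and L-Lipschitz, and let w* be a minimizer of f over 𝒟. Let ρ : ℝ → [−1, 1] be differentiable, anti-symmetric, with ρ(0) = 0, sign(ρ(x)) = sign(x) for x ≠ 0, and such that there are constants p ≥ 1 and r, c_ρ > 0 with ρ'(x) ≥ c_ρ·p·|x|^{p−1} for all x ∈ (−r, r). Fix ε > 0, set c̃ = 1/20, γ = c̃ε/(β√d·D), η = p·c_ρ·c̃^{2p−1}·ε^{2p}/(d^{(2p+1)/2}·β^p·D^{2p−1}), assume 2Lγ ≤ r, and let T = d^{2p+1}·β^{2p}·D^{4p}/(p²·(c̃^{2p−1}c_ρ)²·ε^{4p}) + 1. Consider the random process: w_1 ∈ 𝒟 arbitrary, and for t = 1, …, T: u_t uniform on S^{d−1} independent of the past, o_t ∈ {±1} with conditional mean E[o_t | w_t, u_t] = ρ(f(w_t + γu_t) − f(w_t − γu_t)), and w_{t+1} = Π_𝒟(w_t − η·o_t·u_t). Then min_{t ∈ [T]} E[f(w_t)]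 − f(w*) ≤ ε. -/

import Mathlib

open MeasureTheory ProbabilityTheory
open scoped RealInnerProductSpace

/-- The σ-algebra generated by the observations strictly before round `t`. -/
def dcoPast {Ω : Type} {d : ℕ} (u : ℕ → Ω → EuclideanSpace ℝ (Fin d))
    (o : ℕ → Ω → ℝ) (t : ℕ) : MeasurableSpace Ω :=
  ⨆ (s : ℕ) (_ : s < t),
    MeasurableSpace.comap (u s) inferInstance ⊔ MeasurableSpace.comap (o s) inferInstance

section Deterministic

variable {E : Type*} [NormedAddCommGroup E] [InnerProductSpace ℝ E]

/-- Variational inequality for a nearest-point map onto a convex set. -/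
lemma inner_sub_nearest_nonpos {K : Set E} (hK : Convex ℝ K) {z q : E} (hq : q ∈ K)
    (hmin : ∀ y ∈ K, ‖q - z‖ ≤ ‖y - z‖) {y : E} (hy : y ∈ K) : ⟪z - q, y - q⟫ ≤ 0 := by
  refine (norm_eq_iInf_iff_real_inner_le_zero hK hq).1 ?_ y hy
  have : Nonempty K := ⟨⟨q, hq⟩⟩
  refine le_antisymm (le_ciInf fun y => ?_) (ciInf_le ⟨0, ?_⟩ (⟨q, hq⟩ : K))
  · rw [norm_sub_rev z q, norm_sub_rev z]
    exact hmin y y.2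
  · rintro _ ⟨y, rfl⟩
    exact norm_nonneg _

/-- A nearest-point map onto a convex set is nonexpansive. -/
lemma lipschitzWith_nearest {K : Set E} (hK : Convex ℝ K) {proj : E → E}
    (hmem : ∀ z, proj z ∈ K) (hmin : ∀ z, ∀ y ∈ K, ‖proj z - z‖ ≤ ‖y - z‖) :
    LipschitzWith 1 proj := by
  refine LipschitzWith.of_dist_le_mul fun x y => ?_
  rw [dist_eq_norm, dist_eq_norm, NNReal.coe_one, one_mul]
  have hx := inner_sub_nearest_nonpos hK (hmem x) (hmin x) (hmem y)
  have hy := inner_sub_nearest_nonpos hK (hmem y) (hmin y) (hmem x)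
  have hsum : ‖proj x - proj y‖ ^ 2 ≤ ⟪x - y, proj x - proj y⟫ := by
    rw [← real_inner_self_eq_norm_sq]
    have : ⟪x - y, proj x - proj y⟫ - ⟪proj x - proj y, proj x - proj y⟫
        = -⟪x - proj x, proj y - proj x⟫ - ⟪y - proj y, proj x - proj y⟫ := by
      simp only [inner_sub_left, inner_sub_right]
      ring
    linarith
  have hcs := real_inner_le_norm (x - y) (proj x - proj y)
  by_contra! hlt
  nlinarith [norm_nonneg (x - y), norm_nonneg (proj x - proj y)]

lemma norm_nearest_sub_le {K : Set E} (hK : Convex ℝ K) {z q : E} (hq : q ∈ K)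
    (hmin : ∀ y ∈ K, ‖q - z‖ ≤ ‖y - z‖) {y : E} (hy : y ∈ K) : ‖q - y‖ ≤ ‖z - y‖ := by
  have h := inner_sub_nearest_nonpos hK hq hmin hy
  have hsq : ‖z - y‖ ^ 2 = ‖z - q‖ ^ 2 - 2 * ⟪z - q, y - q⟫ + ‖y - q‖ ^ 2 := by
    rw [← norm_sub_sq_real, sub_sub_sub_cancel_right]
  rw [norm_sub_rev q y]
  refine le_of_sq_le_sq ?_ (norm_nonneg _)
  nlinarith [sq_nonneg ‖z - q‖]

/-- The gradient of a smooth convex function is Lipschitz. -/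
lemma norm_gradient_sub_le {f : E → ℝ} {g : E → E} {β : ℝ} (hβ : 0 < β)
    (hconv : ∀ x y, ⟪g x, y - x⟫ ≤ f y - f x)
    (hsmooth : ∀ x y, f y ≤ f x + ⟪g x, y - x⟫ + β / 2 * ‖y - x‖ ^ 2) (x y : E) :
    ‖g x - g y‖ ≤ β * ‖x - y‖ := by
  have key : ∀ x y, ‖g y - g x‖ ^ 2 / (2 * β) ≤ f y - f x - ⟪g x, y - x⟫ := by
    intro x y
    set h := g y - g x with hh
    have h1 := hconv x (y - (1 / β) • h)
    have h2 := hsmooth y (y - (1 / β) • h)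
    have e1 : ⟪g x, y - (1 / β) • h - x⟫ = ⟪g x, y - x⟫ - 1 / β * ⟪g x, h⟫ := by
      rw [sub_right_comm, inner_sub_right, inner_smul_right]
    have e2 : y - (1 / β) • h - y = -((1 / β) • h) := by abel
    have e3 : ‖h‖ ^ 2 = ⟪g y, h⟫ - ⟪g x, h⟫ := by
      rw [← real_inner_self_eq_norm_sq, ← inner_sub_left]
    rw [e1] at h1
    rw [e2, inner_neg_right, inner_smul_right, norm_neg, norm_smul, Real.norm_eq_abs,
      abs_of_pos (by positivity)] at h2
    have e4 : β / 2 * (1 / β * ‖h‖) ^ 2 = ‖h‖ ^ 2 / (2 * β) := by field_simp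
    have e5 : 1 / β * ⟪g y, h⟫ - 1 / β * ⟪g x, h⟫ = 2 * (‖h‖ ^ 2 / (2 * β)) := by
      rw [← mul_sub, ← e3]
      field_simp
    linarith
  have hxy := key x y
  have hyx := key y x
  have hinner : ⟪g x - g y, x - y⟫ = -⟪g x, y - x⟫ - ⟪g y, x - y⟫ := by
    rw [← inner_neg_right, neg_sub, ← inner_sub_left]
  have hcs := real_inner_le_norm (g x - g y) (x - y)
  rw [norm_sub_rev (g y)] at hxy
  have hdiv : ‖g x - g y‖ ^ 2 / (2 * β) * (2 * β) = ‖g x - g y‖ ^ 2 :=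
    div_mul_cancel₀ _ (by positivity)
  have hmul : ‖g x - g y‖ ^ 2 ≤ β * (‖g x - g y‖ * ‖x - y‖) := by nlinarith
  by_contra! hlt
  nlinarith [norm_nonneg (g x - g y), norm_nonneg (x - y),
    mul_nonneg hβ.le (norm_nonneg (x - y))]

/-- Displacing by `h` changes the slope of a smooth convex function along `v` by at most
`β ‖h‖ ‖v‖`. -/
lemma mul_slope_le_sub {f : E → ℝ} {g : E → E} {β : ℝ} (hβ : 0 < β)
    (hconv : ∀ x y, ⟪g x, y - x⟫ ≤ f y - f x)
    (hsmooth : ∀ x y, f y ≤ f x + ⟪g x, y - x⟫ + β / 2 * ‖y - x‖ ^ 2)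
    {w z z' v : E} {s a : ℝ} (hs : 0 ≤ s) (hz : ‖z - w‖ ≤ a) (hz' : z' = z + s • v) :
    s * (⟪g w, v⟫ - β * a * ‖v‖) ≤ f z' - f z := by
  have h1 := hconv z z'
  rw [hz', add_sub_cancel_left, inner_smul_right, ← hz'] at h1
  have h2 := (norm_gradient_sub_le hβ hconv hsmooth w z)
  rw [norm_sub_rev w z] at h2
  have h3 := real_inner_le_norm (g w - g z) v
  rw [inner_sub_left] at h3
  have h4 : ‖g w - g z‖ * ‖v‖ ≤ β * a * ‖v‖ := by
    gcongr
    exact h2.trans (by gcongr)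
  refine le_trans ?_ h1
  gcongr
  linarith

end Deterministic

/-- A lower bound `c p |x|^(p-1)` on the derivative of an odd function gives a `p`-th power lower
bound on its increments. -/
lemma two_mul_pow_le_sub_of_odd {ρ ρd : ℝ → ℝ} {p : ℕ} {r c : ℝ} (hp : 1 ≤ p) (hc : 0 ≤ c)
    (hdiff : ∀ x, HasDerivAt ρ (ρd x) x) (hanti : ∀ x, ρ (-x) = -ρ x)
    (hlb : ∀ x ∈ Set.Ioo (-r) r, c * p * |x| ^ (p - 1) ≤ ρd x) {a b h : ℝ}
    (ha : |a| ≤ r) (hb : |b| ≤ r) (hh : 0 ≤ h) (hab : 2 * h ≤ a - b) :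
    2 * c * h ^ p ≤ ρ a - ρ b := by
  have h0 : ρ 0 = 0 := by
    have := hanti 0
    rw [neg_zero] at this
    linarith
  have hmono : MonotoneOn (fun x => ρ x - c * x ^ p) (Set.Icc 0 r) := by
    have hd : ∀ x, HasDerivAt (fun x => ρ x - c * x ^ p) (ρd x - c * (p * x ^ (p - 1))) x :=
      fun x => (hdiff x).sub ((hasDerivAt_pow p x).const_mul c)
    refine monotoneOn_of_deriv_nonneg (convex_Icc 0 r)
      (fun x _ => (hd x).continuousAt.continuousWithinAt)
      (fun x _ => (hd x).differentiableAt.differentiableWithinAt) fun x hx => ?_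
    rw [interior_Icc] at hx
    rw [(hd x).deriv]
    have := hlb x ⟨by linarith [hx.1, hx.2], hx.2⟩
    rw [abs_of_pos hx.1] at this
    linarith
  have hnn : ∀ a b, 0 ≤ b → a ≤ r → 2 * h ≤ a - b → 2 * c * h ^ p ≤ ρ a - ρ b := by
    intro a b hb ha hab
    have hm : ρ b - c * b ^ p ≤ ρ a - c * a ^ p :=
      hmono ⟨hb, by linarith⟩ ⟨by linarith, ha⟩ (by linarith)
    have h1 : (a - b) ^ p + b ^ p ≤ (a - b + b) ^ p :=
      pow_add_pow_le (by linarith) hb (by omega)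
    rw [sub_add_cancel] at h1
    have h2 : h ^ p + h ^ p ≤ (a - b) ^ p :=
      (pow_add_pow_le hh hh (by omega)).trans (by gcongr; linarith)
    nlinarith
  rcases le_total 0 b with hb0 | hb0
  · exact hnn a b hb0 (le_of_abs_le ha) hab
  rcases le_total a 0 with ha0 | ha0
  · have := hnn (-b) (-a) (by linarith) (by linarith [neg_le_of_abs_le hb]) (by linarith)
    rw [hanti, hanti] at this
    linarith
  · have hz : ∀ y, 0 ≤ y → y ≤ r → c * y ^ p ≤ ρ y := by
      intro y hy hyr
      have : ρ 0 - c * 0 ^ p ≤ ρ y - c * y ^ p :=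
        hmono ⟨le_rfl, hy.trans hyr⟩ ⟨hy, hyr⟩ hy
      rw [h0, zero_pow (by omega)] at this
      linarith
    have ha' := hz a ha0 (le_of_abs_le ha)
    have hb' := hz (-b) (by linarith) (by linarith [neg_le_of_abs_le hb])
    rw [hanti] at hb'
    have hconv := add_pow_le ha0 (neg_nonneg.2 hb0) p
    have hpow : (2 * h) ^ p ≤ (a + -b) ^ p := by gcongr; linarith
    have h2 : (2 * h) ^ p = 2 ^ (p - 1) * (2 * h ^ p) := by
      rw [mul_pow, ← mul_assoc, ← pow_succ, Nat.sub_add_cancel hp]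
    rw [h2] at hpow
    have h3 : 2 * h ^ p ≤ a ^ p + (-b) ^ p :=
      le_of_mul_le_mul_left (hpow.trans hconv) (by positivity)
    nlinarith

section SphereMeasure

variable {d : ℕ} {μ : Measure (EuclideanSpace ℝ (Fin d))}

lemma integral_comp_isometry
    (hrot : ∀ R : EuclideanSpace ℝ (Fin d) ≃ₗᵢ[ℝ] EuclideanSpace ℝ (Fin d),
      Measure.map (⇑R) μ = μ)
    (R : EuclideanSpace ℝ (Fin d) ≃ₗᵢ[ℝ] EuclideanSpace ℝ (Fin d))
    (F : EuclideanSpace ℝ (Fin d) → ℝ) : ∫ x, F (R x) ∂μ = ∫ x, F x ∂μ :=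
  MeasurePreserving.integral_comp ⟨R.continuous.measurable, hrot R⟩
    R.toHomeomorph.measurableEmbedding F

variable [IsProbabilityMeasure μ]

lemma integrable_of_continuous_of_norm_eq_one (hsph : ∀ᵐ x ∂μ, ‖x‖ = 1)
    {F : EuclideanSpace ℝ (Fin d) → ℝ} (hF : Continuous F) : Integrable F μ := by
  obtain ⟨C, hC⟩ := (isCompact_sphere (0 : EuclideanSpace ℝ (Fin d)) 1).exists_bound_of_continuousOn
    hF.continuousOn
  refine Integrable.of_bound hF.aestronglyMeasurable C ?_
  filter_upwards [hsph] with x hx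
  exact hC x (by simpa using hx)

/-- The second moment of a coordinate under the uniform measure on the sphere. -/
lemma integral_inner_sq_sphere (hd : 0 < d) (hsph : ∀ᵐ x ∂μ, ‖x‖ = 1)
    (hrot : ∀ R : EuclideanSpace ℝ (Fin d) ≃ₗᵢ[ℝ] EuclideanSpace ℝ (Fin d),
      Measure.map (⇑R) μ = μ)
    {e : EuclideanSpace ℝ (Fin d)} (he : ‖e‖ = 1) : ∫ x, ⟪x, e⟫ ^ 2 ∂μ = 1 / d := by
  let b := EuclideanSpace.basisFun (Fin d) ℝ
  have heq : ∀ i, ∫ x, ⟪x, b i⟫ ^ 2 ∂μ = ∫ x, ⟪x, e⟫ ^ 2 ∂μ := by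
    intro i
    have hn : ‖b i‖ = ‖e‖ := by rw [he, b.norm_eq_one]
    rw [← integral_comp_isometry hrot (ℝ ∙ (b i - e))ᗮ.reflection (fun x => ⟪x, e⟫ ^ 2)]
    refine integral_congr_ae (ae_of_all _ fun x => ?_)
    have hR := LinearIsometryEquiv.inner_map_map (ℝ ∙ (b i - e))ᗮ.reflection x (b i)
    rw [Submodule.reflection_sub hn] at hR
    simp only [hR]
  have hsum : ∑ i, ∫ x, ⟪x, b i⟫ ^ 2 ∂μ = 1 := by
    rw [← integral_finsetSum _ fun i _ =>
      integrable_of_continuous_of_norm_eq_one hsph (by fun_prop)]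
    have : ∀ᵐ x ∂μ, ∑ i, ⟪x, b i⟫ ^ 2 = 1 := by
      filter_upwards [hsph] with x hx
      have := b.sum_sq_norm_inner_left x
      simp only [Real.norm_eq_abs, sq_abs] at this
      rw [this, hx, one_pow]
    rw [integral_congr_ae this]
    simp
  rw [Finset.sum_congr rfl fun i _ => heq i, Finset.sum_const, Finset.card_univ, Fintype.card_fin,
    nsmul_eq_mul] at hsum
  rw [eq_div_iff (by positivity), mul_comm]
  exact hsum

/-- Lower bound on the moments of a coordinate under the uniform measure on the sphere. -/
lemma pow_le_integral_abs_inner_pow (hd : 0 < d) (hsph : ∀ᵐ x ∂μ, ‖x‖ = 1)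
    (hrot : ∀ R : EuclideanSpace ℝ (Fin d) ≃ₗᵢ[ℝ] EuclideanSpace ℝ (Fin d),
      Measure.map (⇑R) μ = μ)
    (v : EuclideanSpace ℝ (Fin d)) {n : ℕ} (hn : 2 ≤ n) :
    (‖v‖ / √d) ^ n ≤ ∫ x, |⟪x, v⟫| ^ n ∂μ := by
  have hunit : ∀ e : EuclideanSpace ℝ (Fin d), ‖e‖ = 1 → (1 / √d) ^ n ≤ ∫ x, |⟪x, e⟫| ^ n ∂μ := by
    intro e he
    have hpow : ∀ y : ℝ, (y ^ 2) ^ ((n : ℝ) / 2) = |y| ^ n := by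
      intro y
      rw [← sq_abs, ← Real.rpow_natCast, ← Real.rpow_mul (abs_nonneg y), ← Real.rpow_natCast]
      congr 1
      push_cast
      ring
    have hn' : (1 : ℝ) ≤ n / 2 := by
      rw [le_div_iff₀ two_pos]
      exact_mod_cast hn
    have hJ := (convexOn_rpow hn').map_integral_le (μ := μ) (f := fun x => ⟪x, e⟫ ^ 2)
      (Real.continuous_rpow_const (by linarith)).continuousOn isClosed_Ici
      (ae_of_all _ fun x => sq_nonneg ⟪x, e⟫)
      (integrable_of_continuous_of_norm_eq_one hsph (by fun_prop))
      (integrable_of_continuous_of_norm_eq_one hsph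
        ((Real.continuous_rpow_const (by linarith)).comp (by fun_prop)))
    simp only [hpow] at hJ
    rw [integral_inner_sq_sphere hd hsph hrot he] at hJ
    convert hJ using 1
    rw [← abs_of_nonneg (a := 1 / √(d : ℝ)) (by positivity), ← hpow, div_pow, one_pow,
      Real.sq_sqrt (by positivity)]
  rcases eq_or_ne v 0 with rfl | hv
  · simp [show n ≠ 0 by omega]
  have hv' : ‖v‖ ≠ 0 := norm_ne_zero_iff.2 hv
  have h := hunit (‖v‖⁻¹ • v) (by rw [norm_smul, norm_inv, norm_norm, inv_mul_cancel₀ hv'])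
  have hscale : ∀ x, |⟪x, v⟫| ^ n = ‖v‖ ^ n * |⟪x, ‖v‖⁻¹ • v⟫| ^ n := by
    intro x
    rw [inner_smul_right, abs_mul, abs_inv, abs_norm, mul_pow, ← mul_assoc, ← mul_pow,
      mul_inv_cancel₀ hv', one_pow, one_mul]
  simp only [hscale]
  rw [integral_const_mul, div_eq_mul_one_div, mul_pow]
  gcongr

/-- Reflecting `x` in the hyperplane orthogonal to `v` bounds the mean drift along `v` of
the relative-gradient estimator from below. -/
lemma drift_lower_bound {f : EuclideanSpace ℝ (Fin d) → ℝ}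
    {g : EuclideanSpace ℝ (Fin d) → EuclideanSpace ℝ (Fin d)}
    {β L r c γ M : ℝ} {p : ℕ} {ρ ρd : ℝ → ℝ}
    (hd : 0 < d) (hp : 1 ≤ p) (hβ : 0 < β) (hc : 0 ≤ c) (hγ : 0 ≤ γ)
    (hf : Continuous f)
    (hconv : ∀ x y, ⟪g x, y - x⟫ ≤ f y - f x)
    (hLip : ∀ x y, |f x - f y| ≤ L * ‖x - y‖)
    (hsmooth : ∀ x y, f y ≤ f x + ⟪g x, y - x⟫ + β / 2 * ‖y - x‖ ^ 2)
    (hdiff : ∀ x, HasDerivAt ρ (ρd x) x) (hanti : ∀ x, ρ (-x) = -ρ x)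
    (hlb : ∀ x ∈ Set.Ioo (-r) r, c * p * |x| ^ (p - 1) ≤ ρd x) (hγr : 2 * L * γ ≤ r)
    (hsph : ∀ᵐ x ∂μ, ‖x‖ = 1)
    (hrot : ∀ R : EuclideanSpace ℝ (Fin d) ≃ₗᵢ[ℝ] EuclideanSpace ℝ (Fin d),
      Measure.map (⇑R) μ = μ)
    (w : EuclideanSpace ℝ (Fin d)) {v : EuclideanSpace ℝ (Fin d)} (hv : v ≠ 0)
    (hM0 : 0 ≤ M) (hM : M ≤ ⟪g w, v⟫ - β * γ * ‖v‖) :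
    c * (2 * γ) ^ p * M * (M / ‖v‖) ^ (p - 1) * (1 / √d) ^ (p + 1) ≤
      ∫ x, ρ (f (w + γ • x) - f (w - γ • x)) * ⟪x, v⟫ ∂μ := by
  set Δ : EuclideanSpace ℝ (Fin d) → ℝ := fun x => f (w + γ • x) - f (w - γ • x) with hΔ
  set R := (ℝ ∙ v)ᗮ.reflection with hR
  have hρc : Continuous ρ := continuous_iff_continuousAt.2 fun x => (hdiff x).continuousAt
  have hΔc : Continuous Δ := by fun_prop
  have hvn : 0 < ‖v‖ := norm_pos_iff.2 hv
  have hRv : ∀ x, ⟪R x, v⟫ = -⟪x, v⟫ := by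
    intro x
    have := R.inner_map_map x v
    rw [hR, Submodule.reflection_orthogonalComplement_singleton_eq_neg, inner_neg_right] at this
    rw [← this, neg_neg]
  have hRR : ∀ x, R (R x) = x := fun x => Submodule.reflection_reflection _ x
  have hRx : ∀ x, x = R x + (2 * (⟪x, v⟫ / ‖v‖ ^ 2)) • v := by
    intro x
    rw [hR, Submodule.reflection_orthogonal_apply, Submodule.reflection_singleton_apply,
      real_inner_comm, mul_smul, two_smul, two_smul]
    simp
  have hΔr : ∀ x : EuclideanSpace ℝ (Fin d), ‖x‖ = 1 → |Δ x| ≤ r := by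
    intro x hx
    refine (hLip _ _).trans ?_
    have : w + γ • x - (w - γ • x) = (2 * γ) • x := by module
    rw [this, norm_smul, hx, Real.norm_eq_abs, abs_of_nonneg (by positivity)]
    linarith
  have hhalf : ∀ x : EuclideanSpace ℝ (Fin d), ‖x‖ = 1 → 0 ≤ ⟪x, v⟫ →
      2 * c * (2 * γ * (|⟪x, v⟫| / ‖v‖ ^ 2) * M) ^ p ≤ ρ (Δ x) - ρ (Δ (R x)) := by
    intro x hx hpos
    have hRn : ‖R x‖ = 1 := by rw [R.norm_map, hx]
    rw [abs_of_nonneg hpos]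
    refine two_mul_pow_le_sub_of_odd hp hc hdiff hanti hlb (hΔr x hx) (hΔr _ hRn) (by positivity) ?_
    have hs : 0 ≤ γ * (2 * (⟪x, v⟫ / ‖v‖ ^ 2)) := by positivity
    have hsplit : γ • x = γ • R x + (γ * (2 * (⟪x, v⟫ / ‖v‖ ^ 2))) • v := by
      rw [mul_smul, ← smul_add, ← hRx x]
    have h1 := mul_slope_le_sub hβ hconv hsmooth (w := w) (z := w + γ • R x) (z' := w + γ • x)
      (v := v) (a := γ) hs (by simp [norm_smul, hRn, abs_of_nonneg hγ]) (by rw [hsplit]; abel)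
    have h2 := mul_slope_le_sub hβ hconv hsmooth (w := w) (z := w - γ • x) (z' := w - γ • R x)
      (v := v) (a := γ) hs (by simp [norm_smul, hx, abs_of_nonneg hγ]) (by rw [hsplit]; abel)
    have h3 := mul_le_mul_of_nonneg_left hM hs
    simp only [hΔ]
    linarith
  have hpt : ∀ x : EuclideanSpace ℝ (Fin d), ‖x‖ = 1 →
      2 * c * (2 * γ * M / ‖v‖ ^ 2) ^ p * |⟪x, v⟫| ^ (p + 1) ≤
        ρ (Δ x) * ⟪x, v⟫ + ρ (Δ (R x)) * ⟪R x, v⟫ := by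
    intro x hx
    have hexp : 2 * c * (2 * γ * M / ‖v‖ ^ 2) ^ p * |⟪x, v⟫| ^ (p + 1) =
        2 * c * (2 * γ * (|⟪x, v⟫| / ‖v‖ ^ 2) * M) ^ p * |⟪x, v⟫| := by
      rw [pow_succ |⟪x, v⟫|, show 2 * γ * (|⟪x, v⟫| / ‖v‖ ^ 2) * M =
        2 * γ * M / ‖v‖ ^ 2 * |⟪x, v⟫| by ring, mul_pow _ |⟪x, v⟫|]
      ring
    rw [hexp, hRv]
    rcases le_total 0 ⟪x, v⟫ with hpos | hneg
    · have := mul_le_mul_of_nonneg_right (hhalf x hx hpos) (abs_nonneg ⟪x, v⟫)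
      refine this.trans (le_of_eq ?_)
      rw [abs_of_nonneg hpos]
      ring
    · have := mul_le_mul_of_nonneg_right
        (hhalf (R x) (by rw [R.norm_map, hx]) (by rw [hRv]; linarith)) (abs_nonneg ⟪x, v⟫)
      rw [hRR, hRv, abs_neg] at this
      refine this.trans (le_of_eq ?_)
      rw [abs_of_nonpos hneg]
      ring
  have hint : Integrable (fun x => ρ (Δ x) * ⟪x, v⟫) μ :=
    integrable_of_continuous_of_norm_eq_one hsph (by fun_prop)
  have hint' : Integrable (fun x => ρ (Δ (R x)) * ⟪R x, v⟫) μ :=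
    integrable_of_continuous_of_norm_eq_one hsph
      (((hρc.comp hΔc).mul (by fun_prop : Continuous fun x => ⟪x, v⟫)).comp R.continuous)
  have hle := integral_mono_ae
    (integrable_of_continuous_of_norm_eq_one hsph (by fun_prop :
      Continuous fun x : EuclideanSpace ℝ (Fin d) =>
        2 * c * (2 * γ * M / ‖v‖ ^ 2) ^ p * |⟪x, v⟫| ^ (p + 1)))
    (hint.add hint') (hsph.mono hpt)
  rw [integral_const_mul] at hle
  simp only [Pi.add_apply] at hle
  rw [integral_add hint hint',
    integral_comp_isometry hrot R (fun x => ρ (Δ x) * ⟪x, v⟫)] at hle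
  have hmom := pow_le_integral_abs_inner_pow hd hsph hrot v (n := p + 1) (by omega)
  have hmom' := mul_le_mul_of_nonneg_left hmom
    (by positivity : 0 ≤ 2 * c * (2 * γ * M / ‖v‖ ^ 2) ^ p)
  have hfin : 2 * c * (2 * γ * M / ‖v‖ ^ 2) ^ p * (‖v‖ / √d) ^ (p + 1) =
      2 * (c * (2 * γ) ^ p * M * (M / ‖v‖) ^ (p - 1) * (1 / √d) ^ (p + 1)) := by
    obtain ⟨n, rfl⟩ : ∃ n, p = n + 1 := ⟨p - 1, by omega⟩
    rw [Nat.add_sub_cancel]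
    obtain ⟨m, rfl⟩ : ∃ m, M = m * ‖v‖ := ⟨M / ‖v‖, (div_mul_cancel₀ _ hvn.ne').symm⟩
    rw [mul_div_cancel_right₀ _ hvn.ne', show 2 * γ * (m * ‖v‖) / ‖v‖ ^ 2 = 2 * γ * m / ‖v‖ by
      field_simp]
    have hcancel : (2 * γ * m / ‖v‖) ^ (n + 1) * ‖v‖ ^ (n + 1) = (2 * γ * m) ^ (n + 1) := by
      rw [← mul_pow, div_mul_cancel₀ _ hvn.ne']
    rw [div_eq_mul_one_div ‖v‖, mul_pow ‖v‖, pow_succ ‖v‖ (n + 1)]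
    calc _ = 2 * c * ((2 * γ * m / ‖v‖) ^ (n + 1) * ‖v‖ ^ (n + 1)) * ‖v‖ *
          (1 / √d) ^ (n + 1 + 1) := by ring
      _ = _ := by
        rw [hcancel]
        ring
  linarith

end SphereMeasure

lemma exists_nearest_map {E : Type*} [NormedAddCommGroup E] {K : Set E} (hK : IsCompact K)
    (hne : K.Nonempty) :
    ∃ π : E → E, (∀ z, π z ∈ K) ∧ ∀ z, ∀ y ∈ K, ‖π z - z‖ ≤ ‖y - z‖ := by
  choose π hπ hdist using hK.exists_infDist_eq_dist hne
  refine ⟨π, hπ, fun z y hy => ?_⟩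
  rw [← dist_eq_norm, ← dist_eq_norm, dist_comm, dist_comm y, ← hdist]
  exact Metric.infDist_le_dist_of_mem hy

section Sublevel

variable {E : Type*} [NormedAddCommGroup E] [InnerProductSpace ℝ E]

lemma convexOn_of_inner_gradient_le {f : E → ℝ} {g : E → E} {s : Set E} (hs : Convex ℝ s)
    (hconv : ∀ x y, ⟪g x, y - x⟫ ≤ f y - f x) : ConvexOn ℝ s f := by
  refine ⟨hs, fun x _ y _ a b ha hb hab => ?_⟩
  have hx := mul_le_mul_of_nonneg_left (hconv (a • x + b • y) x) ha
  have hy := mul_le_mul_of_nonneg_left (hconv (a • x + b • y) y) hb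
  set z := a • x + b • y with hz
  have h0 : a * ⟪g z, x - z⟫ + b * ⟪g z, y - z⟫ = 0 := by
    rw [← inner_smul_right, ← inner_smul_right, ← inner_add_right]
    have : a • (x - z) + b • (y - z) = 0 := by
      rw [smul_sub, smul_sub, sub_add_sub_comm, ← add_smul, hab, one_smul, sub_self]
    rw [this, inner_zero_right]
  have hfz : a * f z + b * f z = f z := by rw [← add_mul, hab, one_mul]
  simp only [smul_eq_mul]
  linarith

/-- Error bound: the distance to a sublevel set of a convex function is controlled by the
excess value. -/
lemma norm_sub_nearest_sublevel_mul_le {f : E → ℝ} {s : Set E} (hf : ConvexOn ℝ s f)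
    {w wstar q : E} {a D : ℝ} (hw : w ∈ s) (hws : wstar ∈ s) (ha : 0 ≤ a)
    (hwa : a < f w - f wstar) (hD : ‖w - wstar‖ ≤ D)
    (hq : ∀ y ∈ {x ∈ s | f x ≤ f wstar + a}, ‖q - w‖ ≤ ‖y - w‖) :
    ‖w - q‖ * (f w - f wstar) ≤ D * (f w - f wstar - a) := by
  set δ := f w - f wstar with hδ
  have hδ0 : 0 < δ := ha.trans_lt hwa
  set θ := (δ - a) / δ with hθ
  have hθδ : θ * δ = δ - a := div_mul_cancel₀ _ hδ0.ne'
  have hθ0 : 0 ≤ θ := div_nonneg (by linarith) hδ0.le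
  have hθ1 : 0 ≤ 1 - θ := by
    rw [sub_nonneg, hθ, div_le_one hδ0]
    linarith
  have hmem := hf.1 hw hws hθ1 hθ0 (by ring)
  have hle := hf.2 hw hws hθ1 hθ0 (by ring)
  have hz := hq ((1 - θ) • w + θ • wstar) ⟨hmem, hle.trans (by
    simp only [smul_eq_mul]
    nlinarith)⟩
  have hsub : (1 - θ) • w + θ • wstar - w = θ • (wstar - w) := by module
  rw [hsub, norm_smul, Real.norm_eq_abs, abs_of_nonneg hθ0, norm_sub_rev wstar,
    norm_sub_rev q] at hz
  calc ‖w - q‖ * δ ≤ θ * ‖w - wstar‖ * δ := by gcongr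
    _ = (θ * δ) * ‖w - wstar‖ := by ring
    _ ≤ (θ * δ) * D := by gcongr
    _ = D * (δ - a) := by rw [hθδ, mul_comm]

end Sublevel

/-- Integrating out a fresh direction `U` and a signal whose conditional mean is a function of the
past state `W` and of `U`. -/
lemma integral_signal_mul_eq {Ω E : Type*} [MeasurableSpace E] {m m0 : MeasurableSpace Ω}
    {P : Measure Ω} [IsProbabilityMeasure P] (hm : m ≤ m0) {U W : Ω → E} {o : Ω → ℝ}
    {G H : E × E → ℝ} (hU : Measurable U) (hW : Measurable[m] W) (ho : Measurable o)
    (hobound : ∀ ω, |o ω| ≤ 1)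
    (hindep : Indep (MeasurableSpace.comap U inferInstance) m P)
    (hcond : P[o | m ⊔ MeasurableSpace.comap U inferInstance] =ᵐ[P] fun ω => G (W ω, U ω))
    (hG : Measurable G) (hGbound : ∀ z, |G z| ≤ 1) (hH : Measurable H)
    {C : ℝ} (hHbound : ∀ᵐ ω ∂P, |H (W ω, U ω)| ≤ C) :
    ∫ ω, o ω * H (W ω, U ω) ∂P =
        ∫ ω, ∫ x, G (W ω, x) * H (W ω, x) ∂(P.map U) ∂P ∧
      Integrable (fun ω => ∫ x, G (W ω, x) * H (W ω, x) ∂(P.map U)) P := by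
  have hWm0 : Measurable W := hW.mono hm le_rfl
  have hm' : m ⊔ MeasurableSpace.comap U inferInstance ≤ m0 := sup_le hm hU.comap_le
  have hHm : StronglyMeasurable[m ⊔ MeasurableSpace.comap U inferInstance]
      fun ω => H (W ω, U ω) :=
    (hH.comp ((hW.mono le_sup_left le_rfl).prodMk
      ((comap_measurable U).mono le_sup_right le_rfl))).stronglyMeasurable
  have hHint : Integrable (fun ω => H (W ω, U ω)) P :=
    Integrable.of_bound (hHm.mono hm').aestronglyMeasurable C hHbound
  have hoint : Integrable o P :=
    Integrable.of_bound ho.aestronglyMeasurable 1 (ae_of_all _ hobound)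
  have hHo : Integrable ((fun ω => H (W ω, U ω)) * o) P :=
    hHint.mul_bdd ho.aestronglyMeasurable (ae_of_all _ hobound)
  have hpull := condExp_mul_of_stronglyMeasurable_left hHm hHo hoint
  have hWU : IndepFun W U P :=
    (indep_of_indep_of_le_right hindep hW.comap_le).symm
  have hmap := (indepFun_iff_map_prod_eq_prod_map_map hWm0.aemeasurable hU.aemeasurable).1 hWU
  have hGHm : Measurable fun z => G z * H z := hG.mul hH
  have hGHint : Integrable (fun ω => G (W ω, U ω) * H (W ω, U ω)) P :=
    hHint.bdd_mul (hG.comp (hWm0.prodMk hU)).aestronglyMeasurable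
      (ae_of_all _ fun ω => hGbound _)
  have hprod : Integrable (fun z => G z * H z) ((P.map W).prod (P.map U)) := by
    rw [← hmap]
    exact (integrable_map_measure hGHm.aestronglyMeasurable (hWm0.prodMk hU).aemeasurable).2 hGHint
  have : IsProbabilityMeasure (P.map U) := Measure.isProbabilityMeasure_map hU.aemeasurable
  refine ⟨?_, hprod.integral_prod_left.comp_measurable hWm0⟩
  calc ∫ ω, o ω * H (W ω, U ω) ∂P
      = ∫ ω, ((fun ω => H (W ω, U ω)) * o) ω ∂P := by simp only [Pi.mul_apply, mul_comm]
    _ = ∫ ω, (P[(fun ω => H (W ω, U ω)) * o | m ⊔ MeasurableSpace.comap U inferInstance]) ω ∂P :=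
        (integral_condExp hm').symm
    _ = ∫ ω, G (W ω, U ω) * H (W ω, U ω) ∂P := by
        refine integral_congr_ae ?_
        filter_upwards [hpull, hcond] with ω h1 h2
        rw [h1, Pi.mul_apply, h2, mul_comm]
    _ = ∫ z, G z * H z ∂(P.map fun ω => (W ω, U ω)) :=
        (integral_map (hWm0.prodMk hU).aemeasurable hGHm.aestronglyMeasurable).symm
    _ = ∫ y, ∫ x, G (y, x) * H (y, x) ∂(P.map U) ∂(P.map W) := by
        rw [hmap, integral_prod _ hprod]
    _ = ∫ ω, ∫ x, G (W ω, x) * H (W ω, x) ∂(P.map U) ∂P :=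
        integral_map hWm0.aemeasurable hprod.integral_prod_left.aestronglyMeasurable

section Past

variable {Ω : Type} {d : ℕ} {u : ℕ → Ω → EuclideanSpace ℝ (Fin d)} {o : ℕ → Ω → ℝ}

lemma dcoPast_mono : Monotone (dcoPast u o) := fun _ _ h =>
  iSup_mono fun _ => iSup_mono' fun hs => ⟨hs.trans_le h, le_rfl⟩

lemma dcoPast_le [m0 : MeasurableSpace Ω] (hu : ∀ t, Measurable (u t))
    (ho : ∀ t, Measurable (o t)) (t : ℕ) : dcoPast u o t ≤ m0 :=
  iSup₂_le fun s _ => sup_le (hu s).comap_le (ho s).comap_le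

/-- The iterates are determined by the past observations. -/
lemma measurable_iterate {w : ℕ → Ω → EuclideanSpace ℝ (Fin d)} {w1 : EuclideanSpace ℝ (Fin d)}
    {proj : EuclideanSpace ℝ (Fin d) → EuclideanSpace ℝ (Fin d)} (hproj : Measurable proj) {η : ℝ}
    (hw1 : w 1 = fun _ => w1)
    (hrec : ∀ t, 1 ≤ t → ∀ ω, w (t + 1) ω = proj (w t ω - (η * o t ω) • u t ω))
    {t : ℕ} (ht : 1 ≤ t) : Measurable[dcoPast u o t] (w t) := by
  induction t, ht using Nat.le_induction with
  | base =>
    rw [hw1]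
    exact measurable_const
  | succ t ht ih =>
    have hle : MeasurableSpace.comap (u t) inferInstance ⊔ MeasurableSpace.comap (o t) inferInstance
        ≤ dcoPast u o (t + 1) := le_iSup₂_of_le t t.lt_succ_self le_rfl
    have hut : Measurable[dcoPast u o (t + 1)] (u t) :=
      (comap_measurable (u t)).mono (le_sup_left.trans hle) le_rfl
    have hot : Measurable[dcoPast u o (t + 1)] (o t) :=
      (comap_measurable (o t)).mono (le_sup_right.trans hle) le_rfl
    have hwt : Measurable[dcoPast u o (t + 1)] (w t) := ih.mono (dcoPast_mono t.le_succ) le_rfl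
    rw [funext (hrec t ht)]
    exact hproj.comp (hwt.sub ((hot.const_mul η).smul hut))

end Past

/-- Mean drift of the relative-gradient estimator toward the sublevel set at height `ε / 4` above
the minimum. -/
lemma drift_toward_sublevel {d p : ℕ} {μ : Measure (EuclideanSpace ℝ (Fin d))}
    [IsProbabilityMeasure μ] {f : EuclideanSpace ℝ (Fin d) → ℝ}
    {g : EuclideanSpace ℝ (Fin d) → EuclideanSpace ℝ (Fin d)}
    {β L r c γ ε D : ℝ} {ρ ρd : ℝ → ℝ} {s : Set (EuclideanSpace ℝ (Fin d))}
    (hd : 0 < d) (hp : 1 ≤ p) (hβ : 0 < β) (hc : 0 ≤ c) (hγ : 0 ≤ γ) (hε : 0 < ε) (hD : 0 < D)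
    (hγD : β * γ * D ≤ ε / 20) (hs : Convex ℝ s) (hf : Continuous f)
    (hconv : ∀ x y, ⟪g x, y - x⟫ ≤ f y - f x)
    (hLip : ∀ x y, |f x - f y| ≤ L * ‖x - y‖)
    (hsmooth : ∀ x y, f y ≤ f x + ⟪g x, y - x⟫ + β / 2 * ‖y - x‖ ^ 2)
    (hdiff : ∀ x, HasDerivAt ρ (ρd x) x) (hanti : ∀ x, ρ (-x) = -ρ x)
    (hlb : ∀ x ∈ Set.Ioo (-r) r, c * p * |x| ^ (p - 1) ≤ ρd x) (hγr : 2 * L * γ ≤ r)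
    (hsph : ∀ᵐ x ∂μ, ‖x‖ = 1)
    (hrot : ∀ R : EuclideanSpace ℝ (Fin d) ≃ₗᵢ[ℝ] EuclideanSpace ℝ (Fin d),
      Measure.map (⇑R) μ = μ)
    {w wstar q : EuclideanSpace ℝ (Fin d)} (hw : w ∈ s) (hws : wstar ∈ s)
    (hwD : ‖w - wstar‖ ≤ D) (hq : q ∈ {x ∈ s | f x ≤ f wstar + ε / 4})
    (hqmin : ∀ y ∈ {x ∈ s | f x ≤ f wstar + ε / 4}, ‖q - w‖ ≤ ‖y - w‖) :
    c * (2 * γ) ^ p * (ε / (5 * D)) ^ (p - 1) * (4 / 5) * (1 / √d) ^ (p + 1) *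
        (f w - f wstar - ε / 4) ≤
      ∫ x, ρ (f (w + γ • x) - f (w - γ • x)) * ⟪x, w - q⟫ ∂μ := by
  set A := c * (2 * γ) ^ p * (1 / √(d : ℝ)) ^ (p + 1) with hA
  have hA0 : 0 ≤ A := by positivity
  rcases le_or_gt (f w - f wstar) (ε / 4) with hle | hgt
  · have hqw : q = w := by
      have := hqmin w ⟨hw, by linarith⟩
      rw [sub_self, norm_zero] at this
      exact sub_eq_zero.1 (norm_le_zero_iff.1 this)
    simp only [hqw, sub_self, inner_zero_right, mul_zero, integral_zero]
    exact mul_nonpos_of_nonneg_of_nonpos (by positivity) (by linarith)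
  · set δ := f w - f wstar with hδ
    have hvn := norm_sub_nearest_sublevel_mul_le (convexOn_of_inner_gradient_le hs hconv) hw hws
      (by positivity) hgt hwD hqmin
    rw [← hδ] at hvn
    have hv : w - q ≠ 0 := by
      intro h
      have := hq.2
      rw [← sub_eq_zero.1 h] at this
      linarith
    have hvpos : 0 < ‖w - q‖ := norm_pos_iff.2 hv
    have hslope : δ - ε / 4 ≤ ⟪g w, w - q⟫ := by
      have h1 := hconv w q
      rw [← neg_sub w q, inner_neg_right] at h1
      linarith [hq.2]
    have hmul : ‖w - q‖ * ε ≤ 4 * D * (δ - ε / 4) := by nlinarith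
    have herr : β * γ * ‖w - q‖ ≤ (δ - ε / 4) / 5 := by
      have h1 : β * γ * D * (‖w - q‖ * ε) ≤ ε / 20 * (4 * D * (δ - ε / 4)) :=
        mul_le_mul hγD hmul (by positivity) (by positivity)
      have h2 : D * ε * (β * γ * ‖w - q‖) ≤ D * ε * ((δ - ε / 4) / 5) := by linarith
      exact le_of_mul_le_mul_left h2 (by positivity)
    have hM0 : 0 ≤ 4 / 5 * (δ - ε / 4) := by linarith
    have hdrift := drift_lower_bound hd hp hβ hc hγ hf hconv hLip hsmooth hdiff hanti hlb hγr
      hsph hrot w hv hM0 (by linarith)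
    refine le_trans ?_ hdrift
    have hratio : ε / (5 * D) ≤ 4 / 5 * (δ - ε / 4) / ‖w - q‖ := by
      rw [div_le_div_iff₀ (by positivity) hvpos]
      linarith
    have hpow : (ε / (5 * D)) ^ (p - 1) ≤ (4 / 5 * (δ - ε / 4) / ‖w - q‖) ^ (p - 1) := by gcongr
    have := mul_le_mul_of_nonneg_left hpow (mul_nonneg hA0 hM0)
    calc _ = A * (4 / 5 * (δ - ε / 4)) * (ε / (5 * D)) ^ (p - 1) := by rw [hA]; ring
      _ ≤ _ := this
      _ = _ := by rw [hA]; ring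

/-- The step size is at most the drift available at average suboptimality `ε`. -/
lemma stepSize_le_drift {p : ℕ} (hp : 1 ≤ p) {q β c ε D γ η : ℝ} (hq : 0 < q) (hβ : 0 < β)
    (hc : 0 < c) (hε : 0 < ε) (hD : 0 < D) (hγ : γ = (1 / 20) * ε / (β * q * D))
    (hη : η = (p : ℝ) * c * (1 / 20 : ℝ) ^ (2 * p - 1) * ε ^ (2 * p) /
      (q ^ (2 * p + 1) * β ^ p * D ^ (2 * p - 1))) :
    η ≤ c * (2 * γ) ^ p * (ε / (5 * D)) ^ (p - 1) * (4 / 5) * (1 / q) ^ (p + 1) *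
      (ε - ε / 4) := by
  obtain ⟨n, rfl⟩ : ∃ n, p = n + 1 := ⟨p - 1, by omega⟩
  have hexp : 2 * (n + 1) - 1 = n + n + 1 := by omega
  have hn : (n : ℝ) + 1 ≤ 8 ^ n := by
    have := one_add_mul_le_pow (show (-2 : ℝ) ≤ 7 by norm_num) n
    norm_num at this
    nlinarith [(Nat.cast_nonneg n : (0 : ℝ) ≤ n)]
  set B := c * (1 / 20 : ℝ) ^ (n + n + 1) * ε ^ (2 * (n + 1)) /
      (q ^ (2 * (n + 1) + 1) * β ^ (n + 1) * D ^ (n + n + 1)) with hB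
  have hB0 : 0 ≤ B := by positivity
  have hη' : η = (n + 1) * B := by
    rw [hη, hexp, hB]
    push_cast
    ring
  have hC : c * (2 * γ) ^ (n + 1) * (ε / (5 * D)) ^ (n + 1 - 1) * (4 / 5) * (1 / q) ^ (n + 1 + 1) *
      (ε - ε / 4) = 6 / 5 * 8 ^ n * B := by
    have h8 : (8 : ℝ) ^ n * (1 / 20) ^ n = 2 ^ n * (1 / 5) ^ n := by
      rw [← mul_pow, ← mul_pow]
      norm_num
    rw [hγ, hB, Nat.add_sub_cancel]
    have e1 : (2 * (1 / 20 * ε / (β * q * D))) ^ (n + 1) =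
        2 * 2 ^ n * (1 / 20) * (1 / 20) ^ n * ε ^ (n + 1) / (β ^ (n + 1) * q ^ (n + 1) * D ^ (n + 1)) := by
      rw [← mul_div_assoc, div_pow, mul_pow, mul_pow, mul_pow, mul_pow]
      ring
    have e2 : (ε / (5 * D)) ^ n = (1 / 5) ^ n * ε ^ n / D ^ n := by
      rw [show ε / (5 * D) = 1 / 5 * ε / D by ring, div_pow, mul_pow]
    rw [e1, e2, one_div_pow q]
    calc _ = 6 / 5 * (2 ^ n * (1 / 5) ^ n) * (c * (1 / 20) ^ (n + 1) * ε ^ (2 * (n + 1)) /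
          (q ^ (2 * (n + 1) + 1) * β ^ (n + 1) * D ^ (n + n + 1))) := by
            field_simp
            ring
      _ = _ := by
        rw [← h8]
        ring
  rw [hC, hη']
  have h8 : (0 : ℝ) < 8 ^ n := by positivity
  exact mul_le_mul_of_nonneg_right (by linarith) hB0

/-- The horizon `T` satisfies `(T - 1) η² = D²`. -/
lemma horizon_mul_stepSize_sq {p : ℕ} (hp : 1 ≤ p) {q β c ε D η T a : ℝ} (hq : 0 < q)
    (hβ : 0 < β) (hc : 0 < c) (hε : 0 < ε) (hD : 0 < D) (ha : 0 < a)
    (hη : η = (p : ℝ) * c * a ^ (2 * p - 1) * ε ^ (2 * p) /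
      (q ^ (2 * p + 1) * β ^ p * D ^ (2 * p - 1)))
    (hT : T = (q ^ 2) ^ (2 * p + 1) * β ^ (2 * p) * D ^ (4 * p) /
        ((p : ℝ) ^ 2 * (a ^ (2 * p - 1) * c) ^ 2 * ε ^ (4 * p)) + 1) :
    T * η ^ 2 = D ^ 2 + η ^ 2 := by
  obtain ⟨n, rfl⟩ : ∃ n, p = n + 1 := ⟨p - 1, by omega⟩
  have hexp : 2 * (n + 1) - 1 = n + n + 1 := by omega
  rw [hT, add_mul, one_mul, hη, hexp]
  congr 1
  field_simp
  ring

/-- Convergence of Relative-Gradient-Descent for smooth convex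
objectives: running the projected update `w_{t+1} = Π_𝒟(w_t − η·o_t·u_t)` with
`u_t` uniform on the sphere independent of the past and
`E[o_t | past, u_t] = ρ(f(w_t + γu_t) − f(w_t − γu_t))`, for the stated choices of
`γ`, `η` and `T`, we have `min_{t ∈ [T]} E[f(w_t)] − f(w*) ≤ ε`. -/
theorem stmt12 (d p : ℕ) (hd : 0 < d) (hp : 1 ≤ p)
    (β L r cρ ε D : ℝ)
    (hβ : 0 < β) (hL : 0 < L) (hr : 0 < r) (hcρ : 0 < cρ) (hε : 0 < ε) (hD : 0 < D)
    (𝒟 : Set (EuclideanSpace ℝ (Fin d))) (hconv : Convex ℝ 𝒟) (hclosed : IsClosed 𝒟)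
    (hbdd : Bornology.IsBounded 𝒟) (hdiam : Metric.diam 𝒟 = D)
    (f : EuclideanSpace ℝ (Fin d) → ℝ)
    (gradf : EuclideanSpace ℝ (Fin d) → EuclideanSpace ℝ (Fin d))
    (hdiff : ∀ x, HasGradientAt f (gradf x) x)
    (hconvf : ∀ x y, ⟪gradf x, y - x⟫ ≤ f y - f x)
    (hLip : ∀ x y, |f x - f y| ≤ L * ‖x - y‖)
    (hsmooth : ∀ x y, f y ≤ f x + ⟪gradf x, y - x⟫ + β / 2 * ‖y - x‖ ^ 2)
    (wstar : EuclideanSpace ℝ (Fin d)) (hws : wstar ∈ 𝒟)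
    (hmin : ∀ v ∈ 𝒟, f wstar ≤ f v)
    (ρ ρd : ℝ → ℝ)
    (hρrange : ∀ x, ρ x ∈ Set.Icc (-1 : ℝ) 1)
    (hρdiff : ∀ x, HasDerivAt ρ (ρd x) x)
    (hρanti : ∀ x, ρ (-x) = -ρ x)
    (hρ0 : ρ 0 = 0)
    (hρsign : ∀ x : ℝ, x ≠ 0 → Real.sign (ρ x) = Real.sign x)
    (hρlb : ∀ x ∈ Set.Ioo (-r) r, cρ * p * |x| ^ (p - 1) ≤ ρd x)
    (γ η : ℝ) (hγdef : γ = (1 / 20) * ε / (β * Real.sqrt d * D)) (hγr : 2 * L * γ ≤ r)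
    (hηdef : η = (p : ℝ) * cρ * (1 / 20 : ℝ) ^ (2 * p - 1) * ε ^ (2 * p) /
      ((d : ℝ) ^ ((2 * (p : ℝ) + 1) / 2) * β ^ p * D ^ (2 * p - 1)))
    (T : ℕ) (hT : (T : ℝ) =
      (d : ℝ) ^ (2 * p + 1) * β ^ (2 * p) * D ^ (4 * p) /
        ((p : ℝ) ^ 2 * ((1 / 20 : ℝ) ^ (2 * p - 1) * cρ) ^ 2 * ε ^ (4 * p)) + 1)
    (proj : EuclideanSpace ℝ (Fin d) → EuclideanSpace ℝ (Fin d))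
    (hprojmem : ∀ z, proj z ∈ 𝒟)
    (hproj : ∀ z, ∀ y ∈ 𝒟, ‖proj z - z‖ ≤ ‖y - z‖)
    (μ : Measure (EuclideanSpace ℝ (Fin d))) [IsProbabilityMeasure μ]
    (hsph : ∀ᵐ x ∂μ, ‖x‖ = 1)
    (hrot : ∀ T' : EuclideanSpace ℝ (Fin d) ≃ₗᵢ[ℝ] EuclideanSpace ℝ (Fin d),
      Measure.map (⇑T') μ = μ)
    (Ω : Type) [MeasurableSpace Ω] (P : Measure Ω) [IsProbabilityMeasure P]
    (u : ℕ → Ω → EuclideanSpace ℝ (Fin d)) (hu : ∀ t, Measurable (u t))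
    (hulaw : ∀ t, Measure.map (u t) P = μ)
    (o : ℕ → Ω → ℝ) (ho : ∀ t, Measurable (o t))
    (hosign : ∀ t ω, o t ω = 1 ∨ o t ω = -1)
    (w : ℕ → Ω → EuclideanSpace ℝ (Fin d))
    (w1 : EuclideanSpace ℝ (Fin d)) (hw1mem : w1 ∈ 𝒟) (hw1 : w 1 = fun _ => w1)
    (hrec : ∀ t, 1 ≤ t → ∀ ω, w (t + 1) ω = proj (w t ω - (η * o t ω) • u t ω))
    (hindep : ∀ t, Indep (MeasurableSpace.comap (u t) inferInstance) (dcoPast u o t) P)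
    (hcond : ∀ t, P[o t | dcoPast u o t ⊔ MeasurableSpace.comap (u t) inferInstance]
      =ᵐ[P] fun ω => ρ (f (w t ω + γ • u t ω) - f (w t ω - γ • u t ω))) :
    ∃ t, 1 ≤ t ∧ t ≤ T ∧ (∫ ω, f (w t ω) ∂P) - f wstar ≤ ε := by
  by_contra! hcon
  set q := √(d : ℝ) with hqdef
  have hd' : (1 : ℝ) ≤ d := by exact_mod_cast hd
  have hq1 : 1 ≤ q := Real.one_le_sqrt.2 hd'
  have hq0 : 0 < q := one_pos.trans_le hq1
  have hqsq : q ^ 2 = d := Real.sq_sqrt (by positivity)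
  have hp0 : (0 : ℝ) < p := by exact_mod_cast hp
  have hrpow : (d : ℝ) ^ ((2 * (p : ℝ) + 1) / 2) = q ^ (2 * p + 1) := by
    rw [hqdef, Real.sqrt_eq_rpow, ← Real.rpow_natCast, ← Real.rpow_mul (by positivity)]
    congr 1
    push_cast
    ring
  rw [hrpow] at hηdef
  have hTη := horizon_mul_stepSize_sq (T := T) hp hq0 hβ hcρ hε hD (by norm_num)
    hηdef (by rw [hqsq]; exact hT)
  have hηle := stepSize_le_drift hp hq0 hβ hcρ hε hD hγdef hηdef
  have hη : 0 < η := by rw [hηdef]; positivity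
  have hγ : 0 < γ := by rw [hγdef]; positivity
  have hγD : β * γ * D ≤ ε / 20 := by
    have : β * γ * D = ε / 20 / q := by
      rw [hγdef]
      field_simp
    rw [this]
    exact div_le_self (by positivity) hq1
  have hfc : Continuous f := continuous_iff_continuousAt.2 fun x => (hdiff x).continuousAt
  have hρc : Continuous ρ := continuous_iff_continuousAt.2 fun x => (hρdiff x).continuousAt
  have hDle : ∀ x ∈ 𝒟, ∀ y ∈ 𝒟, ‖x - y‖ ≤ D := by
    intro x hx y hy
    rw [← dist_eq_norm, ← hdiam]
    exact Metric.dist_le_diam_of_mem hbdd hx hy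
  have hKsub : {x ∈ 𝒟 | f x ≤ f wstar + ε / 4} ⊆ 𝒟 := fun x hx => hx.1
  have hKconv : Convex ℝ {x ∈ 𝒟 | f x ≤ f wstar + ε / 4} :=
    (convexOn_of_inner_gradient_le hconv hconvf).convex_le _
  have hKcpt : IsCompact {x ∈ 𝒟 | f x ≤ f wstar + ε / 4} :=
    (Metric.isCompact_of_isClosed_isBounded hclosed hbdd).inter_right
      (isClosed_le hfc continuous_const)
  obtain ⟨π, hπmem, hπmin⟩ := exists_nearest_map hKcpt ⟨wstar, hws, by linarith⟩
  have hπc : Continuous π := (lipschitzWith_nearest hKconv hπmem hπmin).continuous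
  have hprojc : Continuous proj := (lipschitzWith_nearest hconv hprojmem hproj).continuous
  have hwmem : ∀ t, 1 ≤ t → ∀ ω, w t ω ∈ 𝒟 := by
    intro t ht ω
    induction t, ht using Nat.le_induction with
    | base => rw [hw1]; exact hw1mem
    | succ t ht _ => rw [hrec t ht]; exact hprojmem _
  have hpast := dcoPast_le hu ho
  have hwpast : ∀ t, 1 ≤ t → Measurable[dcoPast u o t] (w t) := fun t ht =>
    measurable_iterate hprojc.measurable hw1 hrec ht
  have hwmeas : ∀ t, 1 ≤ t → Measurable (w t) := fun t ht => (hwpast t ht).mono (hpast t) le_rfl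
  have hvD : ∀ t, 1 ≤ t → ∀ ω, ‖w t ω - π (w t ω)‖ ≤ D := fun t ht ω =>
    hDle _ (hwmem t ht ω) _ (hKsub (hπmem _))
  have hunorm : ∀ t, ∀ᵐ ω ∂P, ‖u t ω‖ = 1 := fun t =>
    ae_of_ae_map (hu t).aemeasurable (by rw [hulaw t]; exact hsph)
  have hoabs : ∀ t ω, |o t ω| ≤ 1 := fun t ω => by
    rcases hosign t ω with h | h <;> simp [h]
  have hdistint : ∀ t, 1 ≤ t → Integrable (fun ω => ‖w t ω - π (w t ω)‖ ^ 2) P := by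
    intro t ht
    refine Integrable.of_bound (C := D ^ 2) ?_ (ae_of_all _ fun ω => ?_)
    · exact (((hwmeas t ht).sub (hπc.measurable.comp (hwmeas t ht))).norm.pow_const
        2).aestronglyMeasurable
    · rw [Real.norm_eq_abs, abs_of_nonneg (by positivity)]
      have := hvD t ht ω
      gcongr
  have hfint : ∀ t, 1 ≤ t → Integrable (fun ω => f (w t ω)) P := by
    intro t ht
    obtain ⟨C, hC⟩ := (Metric.isCompact_of_isClosed_isBounded hclosed
      hbdd).exists_bound_of_continuousOn hfc.continuousOn
    exact Integrable.of_bound (hfc.measurable.comp (hwmeas t ht)).aestronglyMeasurable C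
      (ae_of_all _ fun ω => hC _ (hwmem t ht ω))
  have hinner_le : ∀ t, 1 ≤ t → ∀ᵐ ω ∂P, |⟪u t ω, w t ω - π (w t ω)⟫| ≤ D := by
    intro t ht
    filter_upwards [hunorm t] with ω hω
    refine (abs_real_inner_le_norm _ _).trans ?_
    rw [hω, one_mul]
    exact hvD t ht ω
  have hdrift : ∀ t, 1 ≤ t → t ≤ T → η ≤ ∫ ω, o t ω * ⟪u t ω, w t ω - π (w t ω)⟫ ∂P := by
    intro t ht htT
    obtain ⟨heq, hint⟩ := integral_signal_mul_eq (hpast t) (hu t) (hwpast t ht) (ho t) (hoabs t)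
      (hindep t)
      (G := fun z => ρ (f (z.1 + γ • z.2) - f (z.1 - γ • z.2)))
      (H := fun z => ⟪z.2, z.1 - π z.1⟫) (hcond t)
      (by fun_prop) (fun z => abs_le.2 (hρrange _)) (by fun_prop) (hinner_le t ht)
    simp only [hulaw t] at heq hint
    rw [heq]
    set C := cρ * (2 * γ) ^ p * (ε / (5 * D)) ^ (p - 1) * (4 / 5) * (1 / q) ^ (p + 1) with hC
    have hC0 : 0 ≤ C := by positivity
    have hmono := integral_mono (((hfint t ht).sub (integrable_const (f wstar + ε / 4))).const_mul C)
      hint fun ω => by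
        have := drift_toward_sublevel hd hp hβ hcρ.le hγ.le hε hD hγD hconv hfc hconvf hLip hsmooth
          hρdiff hρanti hρlb hγr hsph hrot (hwmem t ht ω) hws (hDle _ (hwmem t ht ω) _ hws)
          (hπmem (w t ω)) (hπmin (w t ω))
        simpa only [Pi.sub_apply, sub_sub] using this
    refine le_trans ?_ hmono
    rw [integral_const_mul]
    simp only [Pi.sub_apply]
    rw [integral_sub (hfint t ht) (integrable_const _), integral_const, probReal_univ, one_smul]
    refine hηle.trans (mul_le_mul_of_nonneg_left ?_ hC0)
    linarith [hcon t ht htT]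
  have hstep : ∀ t, 1 ≤ t → t ≤ T → ∫ ω, ‖w (t + 1) ω - π (w (t + 1) ω)‖ ^ 2 ∂P ≤
      ∫ ω, ‖w t ω - π (w t ω)‖ ^ 2 ∂P - η ^ 2 := by
    intro t ht htT
    have hsigint : Integrable (fun ω => o t ω * ⟪u t ω, w t ω - π (w t ω)⟫) P := by
      refine Integrable.of_bound (C := D) ((ho t).mul ((hu t).inner
        ((hwmeas t ht).sub (hπc.measurable.comp (hwmeas t ht))))).aestronglyMeasurable ?_
      filter_upwards [hinner_le t ht] with ω hω
      rw [Real.norm_eq_abs, abs_mul]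
      exact (mul_le_mul (hoabs t ω) hω (abs_nonneg _) zero_le_one).trans_eq (one_mul D)
    have hpt : ∀ᵐ ω ∂P, ‖w (t + 1) ω - π (w (t + 1) ω)‖ ^ 2 ≤
        ‖w t ω - π (w t ω)‖ ^ 2 - 2 * η * (o t ω * ⟪u t ω, w t ω - π (w t ω)⟫) + η ^ 2 := by
      filter_upwards [hunorm t] with ω hω
      have h1 := hπmin (w (t + 1) ω) _ (hπmem (w t ω))
      rw [norm_sub_rev, norm_sub_rev (π (w t ω))] at h1
      have h2 : ‖w (t + 1) ω - π (w t ω)‖ ≤ ‖w t ω - (η * o t ω) • u t ω - π (w t ω)‖ := by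
        rw [hrec t ht]
        exact norm_nearest_sub_le hconv (hprojmem _) (hproj _) (hKsub (hπmem _))
      have ho2 : o t ω ^ 2 = 1 := by rcases hosign t ω with h | h <;> simp [h]
      calc ‖w (t + 1) ω - π (w (t + 1) ω)‖ ^ 2
          ≤ ‖w t ω - (η * o t ω) • u t ω - π (w t ω)‖ ^ 2 := by
            have := h1.trans h2
            gcongr
        _ = _ := by
            rw [sub_right_comm, norm_sub_sq_real, inner_smul_right, norm_smul, hω, mul_one,
              Real.norm_eq_abs, sq_abs, mul_pow, ho2, real_inner_comm]
            ring
    have hint := integral_mono_ae (hdistint (t + 1) (by omega))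
      (((hdistint t ht).sub (hsigint.const_mul (2 * η))).add (integrable_const (η ^ 2))) hpt
    rw [integral_add' ((hdistint t ht).sub (hsigint.const_mul (2 * η))) (integrable_const _),
      integral_sub' (hdistint t ht) (hsigint.const_mul (2 * η)), integral_const_mul,
      integral_const, probReal_univ, one_smul] at hint
    nlinarith [hdrift t ht htT]
  have hsum : ∀ n : ℕ, n ≤ T → ∫ ω, ‖w (n + 1) ω - π (w (n + 1) ω)‖ ^ 2 ∂P ≤ D ^ 2 - n * η ^ 2 := by
    intro n
    induction n with
    | zero =>
      intro _
      refine (integral_mono (hdistint 1 le_rfl) (integrable_const (D ^ 2)) fun ω => ?_).trans ?_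
      · have := hvD 1 le_rfl ω
        simp only
        gcongr
      · simp
    | succ n ih =>
      intro hn
      have := hstep (n + 1) (by omega) hn
      push_cast
      linarith [ih (by omega)]
  have hfinal := hsum T le_rfl
  have hnonneg : 0 ≤ ∫ ω, ‖w (T + 1) ω - π (w (T + 1) ω)‖ ^ 2 ∂P :=
    integral_nonneg fun ω => by positivity
  nlinarith [sq_pos_of_pos hη]
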